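/- If u ∈ A₁^ρ, then there exists ε₀ > 0 such that u^{1+ε} ∈ A₁^ρ for every 0 < ε ≤ ε₀. -/

import Mathlib

open MeasureTheory

noncomputable section

/-- The axis-parallel cube centered at `x` with "radius" `r = √d · ℓ(Q)/2`,
i.e. side length `2r/√d`. -/
def cube (d : ℕ) (x : EuclideanSpace ℝ (Fin d)) (r : ℝ) :
    Set (EuclideanSpace ℝ (Fin d)) :=
  {y | ∀ i, |y i - x i| ≤ r / Real.sqrt d}

/-- Average `(1/|Q|) ∫_Q w` over the cube `Q(x,r)`. -/
def cubeAvg {d : ℕ} (x : EuclideanSpace ℝ (Fin d)) (r : ℝ)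
    (w : EuclideanSpace ℝ (Fin d) → ℝ) : ℝ :=
  (volume (cube d x r)).toReal⁻¹ * ∫ y in cube d x r, w y

/-- Weighted average `(1/u(Q)) ∫_Q v·u` over the cube `Q(x,r)`. -/
def cubeAvgW {d : ℕ} (x : EuclideanSpace ℝ (Fin d)) (r : ℝ)
    (u v : EuclideanSpace ℝ (Fin d) → ℝ) : ℝ :=
  (∫ y in cube d x r, u y)⁻¹ * ∫ y in cube d x r, v y * u y

/-- Essential infimum of `w` over the cube `Q(x,r)`. -/
def cubeInf {d : ℕ} (x : EuclideanSpace ℝ (Fin d)) (r : ℝ)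
    (w : EuclideanSpace ℝ (Fin d) → ℝ) : ℝ :=
  essInf w (volume.restrict (cube d x r))

/-- Essential supremum of `w` over the cube `Q(x,r)`. -/
def cubeSup {d : ℕ} (x : EuclideanSpace ℝ (Fin d)) (r : ℝ)
    (w : EuclideanSpace ℝ (Fin d) → ℝ) : ℝ :=
  essSup w (volume.restrict (cube d x r))

/-- `ρ` is a critical radius function with constants `C₀ > 0` and `N₀ ≥ 1`:
`C₀⁻¹ ρ(x)(1+|x−y|/ρ(x))^{−N₀} ≤ ρ(y) ≤ C₀ ρ(x)(1+|x−y|/ρ(x))^{N₀/(N₀+1)}`. -/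
def IsCRF {d : ℕ} (ρ : EuclideanSpace ℝ (Fin d) → ℝ) (C₀ N₀ : ℝ) : Prop :=
  (∀ x, 0 < ρ x) ∧
    ∀ x y, C₀⁻¹ * ρ x * (1 + dist x y / ρ x) ^ (-N₀) ≤ ρ y ∧
      ρ y ≤ C₀ * ρ x * (1 + dist x y / ρ x) ^ (N₀ / (N₀ + 1))

/-- A weight: a locally integrable function which is positive a.e. -/
def IsWeight {d : ℕ} (w : EuclideanSpace ℝ (Fin d) → ℝ) : Prop :=
  LocallyIntegrable w volume ∧ ∀ᵐ x ∂(volume : Measure (EuclideanSpace ℝ (Fin d))), 0 < w x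

/-- The class `A₁^{ρ,θ}` with explicit constant `C`. -/
def A1C {d : ℕ} (ρ : EuclideanSpace ℝ (Fin d) → ℝ) (θ C : ℝ)
    (w : EuclideanSpace ℝ (Fin d) → ℝ) : Prop :=
  ∀ x r, 0 < r → cubeAvg x r w ≤ C * (1 + r / ρ x) ^ θ * cubeInf x r w

/-- The class `A₁^{ρ,θ}`. -/
def memA1 {d : ℕ} (ρ : EuclideanSpace ℝ (Fin d) → ℝ) (θ : ℝ)
    (w : EuclideanSpace ℝ (Fin d) → ℝ) : Prop :=
  ∃ C > 0, A1C ρ θ C w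

/-- The class `A₁^ρ = ∪_{θ ≥ 0} A₁^{ρ,θ}`. -/
def A1 {d : ℕ} (ρ : EuclideanSpace ℝ (Fin d) → ℝ)
    (w : EuclideanSpace ℝ (Fin d) → ℝ) : Prop :=
  ∃ θ ≥ 0, memA1 ρ θ w

/-- The class `A_p^{ρ,θ}` (for `1 < p < ∞`) with explicit constant `C`;
here `p' = p/(p-1)`. -/
def ApC {d : ℕ} (ρ : EuclideanSpace ℝ (Fin d) → ℝ) (p θ C : ℝ)
    (w : EuclideanSpace ℝ (Fin d) → ℝ) : Prop :=
  ∀ x r, 0 < r →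
    (cubeAvg x r w) ^ (1 / p) *
      (cubeAvg x r fun y => w y ^ (1 - p / (p - 1))) ^ (1 - 1 / p) ≤
        C * (1 + r / ρ x) ^ θ

/-- The class `A_p^{ρ,θ}` for `1 < p < ∞`. -/
def memAp {d : ℕ} (ρ : EuclideanSpace ℝ (Fin d) → ℝ) (p θ : ℝ)
    (w : EuclideanSpace ℝ (Fin d) → ℝ) : Prop :=
  ∃ C > 0, ApC ρ p θ C w

/-- The class `A_p^ρ = ∪_{θ ≥ 0} A_p^{ρ,θ}` for `1 < p < ∞`. -/
def Ap {d : ℕ} (ρ : EuclideanSpace ℝ (Fin d) → ℝ) (p : ℝ)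
    (w : EuclideanSpace ℝ (Fin d) → ℝ) : Prop :=
  ∃ θ ≥ 0, memAp ρ p θ w

/-- The class `A_∞^ρ = ∪_{p > 1} A_p^ρ`. -/
def Ainf {d : ℕ} (ρ : EuclideanSpace ℝ (Fin d) → ℝ)
    (w : EuclideanSpace ℝ (Fin d) → ℝ) : Prop :=
  ∃ p, 1 < p ∧ Ap ρ p w

/-- The reverse Hölder class `RH_s^{ρ,θ}` with explicit constant `C`. -/
def RHC {d : ℕ} (ρ : EuclideanSpace ℝ (Fin d) → ℝ) (s θ C : ℝ)
    (w : EuclideanSpace ℝ (Fin d) → ℝ) : Prop :=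
  ∀ x r, 0 < r →
    (cubeAvg x r fun y => w y ^ s) ^ (1 / s) ≤
      C * (1 + r / ρ x) ^ θ * cubeAvg x r w

/-- The reverse Hölder class `RH_s^{ρ,θ}`. -/
def memRH {d : ℕ} (ρ : EuclideanSpace ℝ (Fin d) → ℝ) (s θ : ℝ)
    (w : EuclideanSpace ℝ (Fin d) → ℝ) : Prop :=
  ∃ C > 0, RHC ρ s θ C w

/-- The class `RH_s^ρ = ∪_{θ ≥ 0} RH_s^{ρ,θ}`. -/
def RH {d : ℕ} (ρ : EuclideanSpace ℝ (Fin d) → ℝ) (s : ℝ)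
    (w : EuclideanSpace ℝ (Fin d) → ℝ) : Prop :=
  ∃ θ ≥ 0, memRH ρ s θ w

/-- The class `RH_∞^{ρ,θ}` with explicit constant `C`. -/
def RHinfC {d : ℕ} (ρ : EuclideanSpace ℝ (Fin d) → ℝ) (θ C : ℝ)
    (w : EuclideanSpace ℝ (Fin d) → ℝ) : Prop :=
  ∀ x r, 0 < r → cubeSup x r w ≤ C * (1 + r / ρ x) ^ θ * cubeAvg x r w

/-- The class `RH_∞^{ρ,θ}`. -/
def memRHinf {d : ℕ} (ρ : EuclideanSpace ℝ (Fin d) → ℝ) (θ : ℝ)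
    (w : EuclideanSpace ℝ (Fin d) → ℝ) : Prop :=
  ∃ C > 0, RHinfC ρ θ C w

/-- The class `RH_∞^ρ = ∪_{θ ≥ 0} RH_∞^{ρ,θ}`. -/
def RHinf {d : ℕ} (ρ : EuclideanSpace ℝ (Fin d) → ℝ)
    (w : EuclideanSpace ℝ (Fin d) → ℝ) : Prop :=
  ∃ θ ≥ 0, memRHinf ρ θ w

/-- The weighted class `A_p^{ρ,θ}(u)` (for `1 < p < ∞`) with explicit constant `C`. -/
def ApWC {d : ℕ} (ρ u : EuclideanSpace ℝ (Fin d) → ℝ) (p θ C : ℝ)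
    (v : EuclideanSpace ℝ (Fin d) → ℝ) : Prop :=
  ∀ x r, 0 < r →
    (cubeAvgW x r u v) ^ (1 / p) *
      (cubeAvgW x r u fun y => v y ^ (1 - p / (p - 1))) ^ (1 - 1 / p) ≤
        C * (1 + r / ρ x) ^ θ

/-- The weighted class `A_p^{ρ,θ}(u)` for `1 < p < ∞`. -/
def memApW {d : ℕ} (ρ u : EuclideanSpace ℝ (Fin d) → ℝ) (p θ : ℝ)
    (v : EuclideanSpace ℝ (Fin d) → ℝ) : Prop :=
  ∃ C > 0, ApWC ρ u p θ C v

/-- The weighted class `A_p^ρ(u) = ∪_{θ ≥ 0} A_p^{ρ,θ}(u)` for `1 < p < ∞`. -/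
def ApW {d : ℕ} (ρ u : EuclideanSpace ℝ (Fin d) → ℝ) (p : ℝ)
    (v : EuclideanSpace ℝ (Fin d) → ℝ) : Prop :=
  ∃ θ ≥ 0, memApW ρ u p θ v

/-- The weighted class `A₁^{ρ,θ}(u)`. -/
def memA1W {d : ℕ} (ρ u : EuclideanSpace ℝ (Fin d) → ℝ) (θ : ℝ)
    (v : EuclideanSpace ℝ (Fin d) → ℝ) : Prop :=
  ∃ C > 0, ∀ x r, 0 < r → cubeAvgW x r u v ≤ C * (1 + r / ρ x) ^ θ * cubeInf x r v

/-- The weighted class `A₁^ρ(u)`. -/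
def A1W {d : ℕ} (ρ u : EuclideanSpace ℝ (Fin d) → ℝ)
    (v : EuclideanSpace ℝ (Fin d) → ℝ) : Prop :=
  ∃ θ ≥ 0, memA1W ρ u θ v

/-- The weighted class `A_∞^ρ(u) = ∪_{p > 1} A_p^ρ(u)`. -/
def AinfW {d : ℕ} (ρ u : EuclideanSpace ℝ (Fin d) → ℝ)
    (v : EuclideanSpace ℝ (Fin d) → ℝ) : Prop :=
  ∃ p, 1 < p ∧ ApW ρ u p v

section DyadicHelpers

open MeasureTheory Set Filter Topology

/-- half-open box -/
def dyBox {d : ℕ} (a : Fin d → ℝ) (L : ℝ) : Set (Fin d → ℝ) :=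
  Set.pi Set.univ fun i => Set.Ico (a i) (a i + L)

def dyChild {d : ℕ} (a : Fin d → ℝ) (L : ℝ) (e : Fin d → Bool) : Fin d → ℝ :=
  fun i => a i + if e i = true then L / 2 else 0

def dyChi {d : ℕ} (a : Fin d → ℝ) (L : ℝ) (y : Fin d → ℝ) : Fin d → Bool :=
  fun i => decide (a i + L / 2 ≤ y i)

def dyAvg {d : ℕ} (v : (Fin d → ℝ) → ℝ) (a : Fin d → ℝ) (L : ℝ) : ℝ :=
  (L ^ d)⁻¹ * ∫ y in dyBox a L, v y

def dyF {d : ℕ} (v : (Fin d → ℝ) → ℝ) : ℕ → (Fin d → ℝ) → ℝ → (Fin d → ℝ) → ℝ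
  | 0, a, L, _ => dyAvg v a L
  | n + 1, a, L, y => dyF v n (dyChild a L (dyChi a L y)) (L / 2) y

lemma dyBox_mem {d : ℕ} {a : Fin d → ℝ} {L : ℝ} {y : Fin d → ℝ} :
    y ∈ dyBox a L ↔ ∀ i, a i ≤ y i ∧ y i < a i + L := by
  simp [dyBox, Set.mem_pi]

lemma dyBox_meas {d : ℕ} (a : Fin d → ℝ) (L : ℝ) : MeasurableSet (dyBox a L) :=
  MeasurableSet.univ_pi fun _ => measurableSet_Ico

lemma dyBox_vol {d : ℕ} (a : Fin d → ℝ) {L : ℝ} (hL : 0 ≤ L) :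
    volume (dyBox a L) = ENNReal.ofReal (L ^ d) := by
  simp [dyBox, Real.volume_pi_Ico, ENNReal.ofReal_pow hL]

lemma dyChild_mem {d : ℕ} {a : Fin d → ℝ} {L : ℝ} (hL : 0 < L) {y : Fin d → ℝ}
    {e : Fin d → Bool} :
    y ∈ dyBox (dyChild a L e) (L / 2) ↔ y ∈ dyBox a L ∧ dyChi a L y = e := by
  simp only [dyBox_mem, dyChild, dyChi, funext_iff, ← forall_and]
  refine forall_congr' fun i => ?_
  cases e i
  · simp only [Bool.false_eq_true, if_false, decide_eq_false_iff_not, not_le, add_zero]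
    constructor
    · rintro ⟨h1, h2⟩; exact ⟨⟨h1, by linarith⟩, h2⟩
    · rintro ⟨⟨h1, h2⟩, h3⟩; exact ⟨h1, h3⟩
  · simp only [if_true, decide_eq_true_eq]
    constructor
    · rintro ⟨h1, h2⟩; exact ⟨⟨by linarith, by linarith⟩, h1⟩
    · rintro ⟨⟨h1, h2⟩, h3⟩; exact ⟨h3, by linarith⟩

lemma dyChild_sub {d : ℕ} {a : Fin d → ℝ} {L : ℝ} (hL : 0 < L) (e : Fin d → Bool) :
    dyBox (dyChild a L e) (L / 2) ⊆ dyBox a L := fun _ hy => ((dyChild_mem hL).1 hy).1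

lemma dyBox_union {d : ℕ} (a : Fin d → ℝ) {L : ℝ} (hL : 0 < L) :
    dyBox a L = ⋃ e, dyBox (dyChild a L e) (L / 2) := by
  ext y
  simp only [mem_iUnion, dyChild_mem hL]
  simp

lemma dyBox_disj {d : ℕ} (a : Fin d → ℝ) {L : ℝ} (hL : 0 < L) :
    Pairwise (Function.onFun Disjoint fun e => dyBox (dyChild a L e) (L / 2)) := by
  intro e e' hne
  refine Set.disjoint_left.2 fun y hy hy' => hne ?_
  rw [← ((dyChild_mem hL).1 hy).2, ← ((dyChild_mem hL).1 hy').2]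

lemma dyBox_fin {d : ℕ} (a : Fin d → ℝ) {L : ℝ} (hL : 0 ≤ L) :
    volume (dyBox a L) < ⊤ := by
  rw [dyBox_vol a hL]; exact ENNReal.ofReal_lt_top

lemma dyBox_int {d : ℕ} {v : (Fin d → ℝ) → ℝ} (hv : LocallyIntegrable v volume)
    (a : Fin d → ℝ) (L : ℝ) : IntegrableOn v (dyBox a L) := by
  refine (hv.integrableOn_isCompact (isCompact_Icc (a := a) (b := fun i => a i + L))).mono_set ?_
  intro y hy
  rw [dyBox_mem] at hy
  exact ⟨fun i => (hy i).1, fun i => (hy i).2.le⟩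

lemma dyAvg_sum {d : ℕ} {v : (Fin d → ℝ) → ℝ} (hv : LocallyIntegrable v volume)
    (a : Fin d → ℝ) {L : ℝ} (hL : 0 < L) :
    ∑ e, (L / 2) ^ d * dyAvg v (dyChild a L e) (L / 2) = L ^ d * dyAvg v a L := by
  unfold dyAvg
  rw [mul_inv_cancel_left₀ (by positivity), dyBox_union a hL,
    integral_iUnion_fintype (fun e => dyBox_meas _ _) (dyBox_disj a hL)
      (fun e => dyBox_int hv _ _)]
  refine Finset.sum_congr rfl fun e _ => ?_
  rw [mul_inv_cancel_left₀ (by positivity)]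

lemma dyAvg_nonneg {d : ℕ} {v : (Fin d → ℝ) → ℝ} (h0 : ∀ᵐ y, 0 ≤ v y)
    (a : Fin d → ℝ) {L : ℝ} (hL : 0 < L) : 0 ≤ dyAvg v a L :=
  mul_nonneg (by positivity) (integral_nonneg_of_ae (ae_restrict_of_ae h0))

lemma dyAvg_mono {d : ℕ} {v : (Fin d → ℝ) → ℝ} (hv : LocallyIntegrable v volume)
    (h0 : ∀ᵐ y, 0 ≤ v y) {a b : Fin d → ℝ} {L l : ℝ} (hL : 0 < L) (hl : 0 < l)
    (hs : dyBox b l ⊆ dyBox a L) :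
    dyAvg v b l ≤ (L / l) ^ d * dyAvg v a L := by
  unfold dyAvg
  have := setIntegral_mono_set (dyBox_int hv a L) (ae_restrict_of_ae h0)
    (LE.le.eventuallyLE hs)
  calc (l ^ d)⁻¹ * ∫ y in dyBox b l, v y ≤ (l ^ d)⁻¹ * ∫ y in dyBox a L, v y := by gcongr
    _ = _ := by rw [div_pow]; field_simp

/-- elementary inequality -/
lemma dy_elem {ε D M m : ℝ} (hε : 0 < ε) (hε1 : ε ≤ 1) (hM : 0 ≤ M) (hm : 0 ≤ m)
    (hD : 0 ≤ D) (hmM : m ≤ D * M) :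
    max M m ^ ε * m - (D * ε) * max M m ^ (1 + ε) ≤ M ^ ε * m - (D * ε) * M ^ (1 + ε) := by
  rcases le_total m M with h | h
  · rw [max_eq_left h]
  rw [max_eq_right h]
  rcases hM.eq_or_lt with rfl | hM
  · have : m = 0 := by linarith
    rw [this]
  obtain ⟨s, hs, rfl⟩ : ∃ s, 1 ≤ s ∧ m = M * s :=
    ⟨m / M, (one_le_div hM).2 h, by field_simp⟩
  have hsD : s ≤ D := by nlinarith
  have h1 : s ^ ε ≤ 1 + ε * (s - 1) := by
    have := rpow_one_add_le_one_add_mul_self (s := s - 1) (by linarith) hε.le hε1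
    simpa using this
  have h2 : s ≤ s ^ (1 + ε) := by
    simpa using Real.rpow_le_rpow_of_exponent_le hs (by linarith : (1 : ℝ) ≤ 1 + ε)
  rw [Real.mul_rpow hM.le (by linarith), Real.mul_rpow hM.le (by linarith),
    Real.rpow_add hM, Real.rpow_one]
  have hMe : 0 < M ^ ε := Real.rpow_pos_of_pos hM _
  have key : s * (s ^ ε - 1) ≤ D * ε * (s ^ (1 + ε) - 1) := by
    calc s * (s ^ ε - 1) ≤ D * (ε * (s - 1)) := by
          apply mul_le_mul hsD (by linarith) _ hD
          linarith [Real.one_le_rpow hs hε.le]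
      _ ≤ D * (ε * (s ^ (1 + ε) - 1)) := by gcongr
      _ = _ := by ring
  have := mul_le_mul_of_nonneg_left key (mul_pos hM hMe).le
  nlinarith

lemma dy_avg_le {d : ℕ} {v : (Fin d → ℝ) → ℝ} (hv : LocallyIntegrable v volume)
    {a : Fin d → ℝ} {L : ℝ} (hL : 0 < L) {K M : ℝ}
    (h : ∀ᵐ y ∂volume.restrict (dyBox a L), M ≤ K * v y) : M ≤ K * dyAvg v a L := by
  have hf : IsFiniteMeasure (volume.restrict (dyBox a L)) :=
    ⟨by rw [Measure.restrict_apply_univ]; exact dyBox_fin a hL.le⟩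
  have := integral_mono_ae (integrable_const M) ((dyBox_int hv a L).const_mul K) h
  rw [integral_const, integral_const_mul, Measure.real, Measure.restrict_apply_univ,
    dyBox_vol a hL.le, ENNReal.toReal_ofReal (by positivity), smul_eq_mul] at this
  unfold dyAvg
  rw [← mul_le_mul_iff_right₀ (show 0 < L ^ d by positivity)]
  calc _ ≤ _ := this
    _ = _ := by field_simp

/-- Bellman function induction -/
lemma dy_bellman {d : ℕ} {v : (Fin d → ℝ) → ℝ} (hv : LocallyIntegrable v volume)
    (h0 : ∀ᵐ y, 0 ≤ v y) {K ε : ℝ} (hε : 0 < ε) (hε1 : ε ≤ 1)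
    (hK : 2 ^ d * ε * K ≤ 1 / 2) (n : ℕ) :
    ∀ (a : Fin d → ℝ) (L M : ℝ), 0 < L →
      (∀ b l, 0 < l → l ≤ L → dyBox b l ⊆ dyBox a L →
        ∀ᵐ y ∂volume.restrict (dyBox b l), dyAvg v b l ≤ K * v y) →
      dyAvg v a L ≤ M → (∀ᵐ y ∂volume.restrict (dyBox a L), M ≤ K * v y) →
      ∫⁻ y in dyBox a L, ENNReal.ofReal (dyF v n a L y ^ (1 + ε)) ≤
        ENNReal.ofReal (2 * (L ^ d * (M ^ ε * dyAvg v a L - (2 ^ d * ε) * M ^ (1 + ε)))) := by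
  have base : ∀ (a : Fin d → ℝ) (L M : ℝ), 0 < L →
      dyAvg v a L ≤ M → (∀ᵐ y ∂volume.restrict (dyBox a L), M ≤ K * v y) →
      dyAvg v a L ^ (1 + ε) ≤ 2 * (M ^ ε * dyAvg v a L - (2 ^ d * ε) * M ^ (1 + ε)) := by
    intro a L M hL hM hMK
    have hm := dyAvg_nonneg h0 a hL
    have hMK' := dy_avg_le hv hL hMK
    set m := dyAvg v a L
    have hM0 : 0 ≤ M := hm.trans hM
    have e1 : ∀ x : ℝ, 0 ≤ x → x ^ (1 + ε) = x ^ ε * x := fun x hx => by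
      rw [Real.rpow_add' hx (by linarith), Real.rpow_one, mul_comm]
    rw [e1 m hm, e1 M hM0]
    have h3 : m ^ ε ≤ M ^ ε := Real.rpow_le_rpow hm hM hε.le
    have h4 : 0 ≤ M ^ ε := Real.rpow_nonneg hM0 _
    have h5 : 2 ^ d * ε * M ≤ 1 / 2 * m := by
      calc 2 ^ d * ε * M ≤ 2 ^ d * ε * (K * m) := by gcongr
        _ = (2 ^ d * ε * K) * m := by ring
        _ ≤ _ := by gcongr
    nlinarith [mul_le_mul_of_nonneg_left h5 h4, mul_le_mul_of_nonneg_right h3 hm]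
  have base' : ∀ (a : Fin d → ℝ) (L M : ℝ), 0 < L →
      dyAvg v a L ≤ M → (∀ᵐ y ∂volume.restrict (dyBox a L), M ≤ K * v y) →
      0 ≤ 2 * (L ^ d * (M ^ ε * dyAvg v a L - (2 ^ d * ε) * M ^ (1 + ε))) := by
    intro a L M hL hM hMK
    have := base a L M hL hM hMK
    have h1 := Real.rpow_nonneg (dyAvg_nonneg h0 a hL) (1 + ε)
    have : 0 ≤ (M ^ ε * dyAvg v a L - (2 ^ d * ε) * M ^ (1 + ε)) := by linarith
    positivity
  induction n with
  | zero =>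
    intro a L M hL _ hM hMK
    simp only [dyF]
    rw [setLIntegral_const, dyBox_vol a hL.le, ← ENNReal.ofReal_mul
      (Real.rpow_nonneg (dyAvg_nonneg h0 a hL) _)]
    apply ENNReal.ofReal_le_ofReal
    have := mul_le_mul_of_nonneg_left (base a L M hL hM hMK) (show 0 ≤ L ^ d by positivity)
    linarith
  | succ n ih =>
    intro a L M hL H hM hMK
    have hL2 : 0 < L / 2 := by positivity
    have hm := dyAvg_nonneg h0 a hL
    have hM0 : 0 ≤ M := hm.trans hM
    have hmax : ∀ e, ∀ᵐ y ∂volume.restrict (dyBox (dyChild a L e) (L / 2)),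
        max M (dyAvg v (dyChild a L e) (L / 2)) ≤ K * v y := by
      intro e
      filter_upwards [ae_restrict_of_ae_restrict_of_subset (dyChild_sub hL e) hMK,
        H _ _ hL2 (by linarith) (dyChild_sub hL e)] with y h1 h2 using max_le h1 h2
    calc ∫⁻ y in dyBox a L, ENNReal.ofReal (dyF v (n + 1) a L y ^ (1 + ε))
        ≤ ∑ e, ∫⁻ y in dyBox (dyChild a L e) (L / 2),
            ENNReal.ofReal (dyF v (n + 1) a L y ^ (1 + ε)) := by
          conv_lhs => rw [dyBox_union a hL]
          refine (lintegral_iUnion_le _ _).trans ?_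
          rw [tsum_fintype]
      _ = ∑ e, ∫⁻ y in dyBox (dyChild a L e) (L / 2),
            ENNReal.ofReal (dyF v n (dyChild a L e) (L / 2) y ^ (1 + ε)) := by
          refine Finset.sum_congr rfl fun e _ => ?_
          refine setLIntegral_congr_fun (dyBox_meas _ _) fun y hy => ?_
          simp only [dyF]
          rw [((dyChild_mem hL).1 hy).2]
      _ ≤ ∑ e, ENNReal.ofReal (2 * ((L / 2) ^ d *
            (max M (dyAvg v (dyChild a L e) (L / 2)) ^ ε * dyAvg v (dyChild a L e) (L / 2) -
              (2 ^ d * ε) * max M (dyAvg v (dyChild a L e) (L / 2)) ^ (1 + ε)))) := by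
          refine Finset.sum_le_sum fun e _ => ?_
          refine ih _ _ _ hL2 ?_ (le_max_right _ _) (hmax e)
          intro b l hl hlL hs
          exact H b l hl (by linarith) (hs.trans (dyChild_sub hL e))
      _ = ENNReal.ofReal (∑ e, 2 * ((L / 2) ^ d *
            (max M (dyAvg v (dyChild a L e) (L / 2)) ^ ε * dyAvg v (dyChild a L e) (L / 2) -
              (2 ^ d * ε) * max M (dyAvg v (dyChild a L e) (L / 2)) ^ (1 + ε)))) := by
          rw [ENNReal.ofReal_sum_of_nonneg]
          intro e _
          exact base' _ _ _ hL2 (le_max_right _ _) (hmax e)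
      _ ≤ _ := by
          apply ENNReal.ofReal_le_ofReal
          calc _ ≤ ∑ e : Fin d → Bool, 2 * ((L / 2) ^ d *
              (M ^ ε * dyAvg v (dyChild a L e) (L / 2) - (2 ^ d * ε) * M ^ (1 + ε))) := by
                refine Finset.sum_le_sum fun e _ => ?_
                have hme := dyAvg_nonneg h0 (dyChild a L e) hL2
                have := dyAvg_mono hv h0 hL hL2 (dyChild_sub (a := a) hL e)
                have h2 : L / (L / 2) = 2 := by field_simp
                rw [h2] at this
                have := dy_elem hε hε1 hM0 hme (show (0 : ℝ) ≤ 2 ^ d by positivity)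
                  (this.trans (by gcongr))
                gcongr
            _ = 2 * (M ^ ε * ∑ e : Fin d → Bool, (L / 2) ^ d * dyAvg v (dyChild a L e) (L / 2)
                - ∑ e : Fin d → Bool, (L / 2) ^ d * ((2 ^ d * ε) * M ^ (1 + ε))) := by
                rw [Finset.mul_sum, ← Finset.sum_sub_distrib, Finset.mul_sum]
                refine Finset.sum_congr rfl fun e _ => ?_
                ring
            _ = _ := by
                rw [dyAvg_sum hv a hL, Finset.sum_const, Finset.card_univ]
                simp only [Fintype.card_fun, Fintype.card_bool, Fintype.card_fin, nsmul_eq_mul,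
                  Nat.cast_pow, Nat.cast_ofNat, div_pow]
                field_simp
            _ ≤ _ := le_refl _

lemma dyF_meas {d : ℕ} (v : (Fin d → ℝ) → ℝ) (n : ℕ) :
    ∀ (a : Fin d → ℝ) (L : ℝ), Measurable (dyF v n a L) := by
  induction n with
  | zero => intro a L; exact measurable_const
  | succ n ih =>
    intro a L
    have h1 : Measurable (dyChi a L) := by
      refine measurable_pi_lambda _ fun i => ?_
      refine measurable_to_bool ?_
      have : (fun y : Fin d → ℝ => dyChi a L y i) ⁻¹' {true} = {y | a i + L / 2 ≤ y i} := by
        ext y; simp [dyChi]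
      rw [this]
      exact measurableSet_le measurable_const (measurable_pi_apply i)
    have h2 : Measurable (fun p : (Fin d → Bool) × (Fin d → ℝ) =>
        dyF v n (dyChild a L p.1) (L / 2) p.2) :=
      measurable_from_prod_countable_right fun e => ih (dyChild a L e) (L / 2)
    exact h2.comp (h1.prodMk measurable_id)

lemma dyF_corner {d : ℕ} (v : (Fin d → ℝ) → ℝ) (n : ℕ) :
    ∀ (a : Fin d → ℝ) (L : ℝ) (y : Fin d → ℝ), 0 < L → y ∈ dyBox a L →
      ∃ c, y ∈ dyBox c (L / 2 ^ n) ∧ dyF v n a L y = dyAvg v c (L / 2 ^ n) := by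
  induction n with
  | zero => intro a L y hL hy; exact ⟨a, by simpa using hy, by simp [dyF]⟩
  | succ n ih =>
    intro a L y hL hy
    obtain ⟨c, h1, h2⟩ := ih (dyChild a L (dyChi a L y)) (L / 2) y (by positivity)
      ((dyChild_mem hL).2 ⟨hy, rfl⟩)
    have : L / 2 / 2 ^ n = L / 2 ^ (n + 1) := by rw [pow_succ]; field_simp
    rw [this] at h1 h2
    exact ⟨c, h1, h2⟩

lemma dyBox_ae_ball {d : ℕ} (c : Fin d → ℝ) {l : ℝ} (hl : 0 < l) :
    dyBox c l =ᵐ[volume] Metric.closedBall (fun i => c i + l / 2) (l / 2) := by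
  have h : Metric.closedBall (fun i => c i + l / 2) (l / 2) = Set.Icc c (fun i => c i + l) := by
    rw [closedBall_pi _ (by positivity), ← pi_univ_Icc]
    congr 1; ext i : 1
    rw [Real.closedBall_eq_Icc]
    congr 1 <;> ring
  rw [h]
  exact Measure.univ_pi_Ico_ae_eq_Icc

lemma dyAvg_eq_average {d : ℕ} (v : (Fin d → ℝ) → ℝ) (c : Fin d → ℝ) {l : ℝ} (hl : 0 < l) :
    dyAvg v c l = ⨍ y in Metric.closedBall (fun i => c i + l / 2) (l / 2), v y := by
  rw [setAverage_eq, ← setIntegral_congr_set (dyBox_ae_ball c hl), Measure.real,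
    ← measure_congr (dyBox_ae_ball c hl), dyBox_vol c hl.le,
    ENNReal.toReal_ofReal (by positivity)]
  rfl

lemma dyF_tendsto {d : ℕ} {v : (Fin d → ℝ) → ℝ} (hv : LocallyIntegrable v volume)
    (a : Fin d → ℝ) {L : ℝ} (hL : 0 < L) :
    ∀ᵐ y ∂volume.restrict (dyBox a L),
      Tendsto (fun n => dyF v n a L y) atTop (𝓝 (v y)) := by
  filter_upwards [ae_restrict_of_ae (IsUnifLocDoublingMeasure.ae_tendsto_average volume hv 1),
    ae_restrict_mem (dyBox_meas a L)] with y hy hmem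
  choose c h1 h2 using fun n => dyF_corner v n a L y hL hmem
  have hp : ∀ n : ℕ, 0 < L / 2 ^ n := fun n => by positivity
  have := hy (l := atTop) (fun n i => c n i + L / 2 ^ n / 2) (fun n => L / 2 ^ n / 2) ?_ ?_
  · refine this.congr fun n => ?_
    rw [h2 n, dyAvg_eq_average v (c n) (hp n)]
  · refine tendsto_nhdsWithin_iff.2 ⟨?_, Eventually.of_forall fun n => half_pos (hp n)⟩
    have : Tendsto (fun n : ℕ => L / 2 * (1 / 2 : ℝ) ^ n) atTop (𝓝 (L / 2 * 0)) :=
      (tendsto_pow_atTop_nhds_zero_of_lt_one (by norm_num) (by norm_num)).const_mul _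
    rw [mul_zero] at this
    refine this.congr fun n => ?_
    rw [one_div, inv_pow]; field_simp
  · refine Eventually.of_forall fun n => ?_
    rw [one_mul, closedBall_pi _ (half_pos (hp n)).le]
    intro i _
    have := dyBox_mem.1 (h1 n) i
    change y i ∈ Metric.closedBall (c n i + L / 2 ^ n / 2) (L / 2 ^ n / 2)
    rw [Real.closedBall_eq_Icc]
    constructor <;> linarith [this.1, this.2]

/-- local reverse Hölder -/
lemma dy_RH {d : ℕ} {v : (Fin d → ℝ) → ℝ} (hv : LocallyIntegrable v volume)
    (h0 : ∀ᵐ y, 0 ≤ v y) {K ε : ℝ} (hε : 0 < ε) (hε1 : ε ≤ 1)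
    (hK : 2 ^ d * ε * K ≤ 1 / 2) (a : Fin d → ℝ) {L : ℝ} (hL : 0 < L)
    (H : ∀ b l, 0 < l → l ≤ L → dyBox b l ⊆ dyBox a L →
        ∀ᵐ y ∂volume.restrict (dyBox b l), dyAvg v b l ≤ K * v y) :
    ∫⁻ y in dyBox a L, ENNReal.ofReal (v y ^ (1 + ε)) ≤
      ENNReal.ofReal (2 * (L ^ d * dyAvg v a L ^ (1 + ε))) := by
  have hm := dyAvg_nonneg h0 a hL
  have key : ∀ n, ∫⁻ y in dyBox a L, ENNReal.ofReal (dyF v n a L y ^ (1 + ε)) ≤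
      ENNReal.ofReal (2 * (L ^ d * dyAvg v a L ^ (1 + ε))) := fun n => by
    refine (dy_bellman hv h0 hε hε1 hK n a L _ hL H le_rfl (H a L hL le_rfl le_rfl)).trans ?_
    apply ENNReal.ofReal_le_ofReal
    have e1 : dyAvg v a L ^ (1 + ε) = dyAvg v a L ^ ε * dyAvg v a L := by
      rw [Real.rpow_add' hm (by linarith), Real.rpow_one, mul_comm]
    have : 0 ≤ 2 ^ d * ε * dyAvg v a L ^ (1 + ε) := by positivity
    gcongr
    linarith
  calc ∫⁻ y in dyBox a L, ENNReal.ofReal (v y ^ (1 + ε))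
      = ∫⁻ y in dyBox a L, liminf (fun n => ENNReal.ofReal (dyF v n a L y ^ (1 + ε))) atTop := by
        refine lintegral_congr_ae ?_
        filter_upwards [dyF_tendsto hv a hL] with y hy
        refine (Tendsto.liminf_eq ?_).symm
        exact ENNReal.tendsto_ofReal (hy.rpow_const (Or.inr (by linarith)))
    _ ≤ liminf (fun n => ∫⁻ y in dyBox a L, ENNReal.ofReal (dyF v n a L y ^ (1 + ε))) atTop :=
        lintegral_liminf_le fun n => ((dyF_meas v n a L).pow_const _).ennreal_ofReal
    _ ≤ liminf (fun _ : ℕ => ENNReal.ofReal (2 * (L ^ d * dyAvg v a L ^ (1 + ε)))) atTop :=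
        liminf_le_liminf (Eventually.of_forall key)
    _ = _ := liminf_const _

/-- subdivision -/
lemma dy_subdiv {d : ℕ} (g : (Fin d → ℝ) → ENNReal) (c : ENNReal) (n : ℕ) :
    ∀ (a : Fin d → ℝ) (L : ℝ), 0 < L →
      (∀ b, dyBox b (L / 2 ^ n) ⊆ dyBox a L →
        ∫⁻ y in dyBox b (L / 2 ^ n), g y ≤ c * volume (dyBox b (L / 2 ^ n))) →
      ∫⁻ y in dyBox a L, g y ≤ c * volume (dyBox a L) := by
  induction n with
  | zero => intro a L hL H; simpa using H a (by simp)
  | succ n ih =>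
    intro a L hL H
    have e : L / 2 / 2 ^ n = L / 2 ^ (n + 1) := by rw [pow_succ]; field_simp
    rw [dyBox_union a hL, measure_iUnion (dyBox_disj a hL) (fun e => dyBox_meas _ _),
      tsum_fintype, Finset.mul_sum]
    refine (lintegral_iUnion_le _ _).trans ?_
    rw [tsum_fintype]
    refine Finset.sum_le_sum fun i _ => ih _ _ (by positivity) ?_
    rw [e]
    intro b hb
    exact H b (hb.trans (dyChild_sub hL i))

lemma dy_le_essInf {α : Type*} [MeasurableSpace α] {μ : Measure α} (hμ : μ ≠ 0) {f : α → ℝ}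
    {c : ℝ} (h : ∀ᵐ x ∂μ, c ≤ f x) : c ≤ essInf f μ := by
  have : NeBot (ae μ) := ae_neBot.2 hμ
  refine le_liminf_of_le ?_ h
  have hex : ∃ n : ℕ, ∃ᶠ x in ae μ, f x ≤ n := by
    by_contra hcon
    push Not at hcon
    have h2 : ∀ᵐ x ∂μ, ∀ n : ℕ, ¬ f x ≤ n :=
      ae_all_iff.2 fun n => by simpa [not_frequently] using hcon n
    obtain ⟨x, hx⟩ := h2.exists
    obtain ⟨n, hn⟩ := exists_nat_ge (f x)
    exact hx n hn
  obtain ⟨n, hn⟩ := hex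
  exact IsCoboundedUnder.of_frequently_le hn

lemma dy_essInf_le {α : Type*} [MeasurableSpace α] {μ : Measure α} {f : α → ℝ}
    (h : ∀ᵐ x ∂μ, 0 ≤ f x) : ∀ᵐ x ∂μ, essInf f μ ≤ f x :=
  ae_essInf_le (isBoundedUnder_of_eventually_ge h)

def dyV {d : ℕ} (u : EuclideanSpace ℝ (Fin d) → ℝ) : (Fin d → ℝ) → ℝ :=
  fun y => u (WithLp.toLp 2 y)

def dyX {d : ℕ} (b : Fin d → ℝ) (l : ℝ) : EuclideanSpace ℝ (Fin d) :=
  WithLp.toLp 2 (fun i => b i + l / 2)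

lemma dy_pre {d : ℕ} (hd : 0 < d) (b : Fin d → ℝ) {l : ℝ} (hl : 0 < l) :
    (MeasurableEquiv.toLp 2 (Fin d → ℝ)) ⁻¹' (cube d (dyX b l) (l * Real.sqrt d / 2)) =
      Metric.closedBall (fun i => b i + l / 2) (l / 2) := by
  have hs : 0 < Real.sqrt d := Real.sqrt_pos.2 (by exact_mod_cast hd)
  have e : l * Real.sqrt d / 2 / Real.sqrt d = l / 2 := by field_simp
  ext y
  rw [closedBall_pi _ (by positivity)]
  simp [cube, dyX, e, Set.mem_pi, Real.dist_eq]

lemma dy_mp (d : ℕ) : MeasurePreserving (MeasurableEquiv.toLp 2 (Fin d → ℝ)) volume volume :=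
  PiLp.volume_preserving_toLp (Fin d)

lemma dy_cube_vol {d : ℕ} (hd : 0 < d) (b : Fin d → ℝ) {l : ℝ} (hl : 0 < l) :
    volume (cube d (dyX b l) (l * Real.sqrt d / 2)) = ENNReal.ofReal (l ^ d) := by
  rw [← (dy_mp d).measure_preimage_equiv, dy_pre hd b hl,
    ← measure_congr (dyBox_ae_ball b hl), dyBox_vol b hl.le]

lemma dy_cubeAvg {d : ℕ} (hd : 0 < d) (b : Fin d → ℝ) {l : ℝ} (hl : 0 < l)
    (w : EuclideanSpace ℝ (Fin d) → ℝ) :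
    cubeAvg (dyX b l) (l * Real.sqrt d / 2) w = dyAvg (dyV w) b l := by
  unfold cubeAvg dyAvg
  rw [dy_cube_vol hd b hl, ENNReal.toReal_ofReal (by positivity),
    ← (dy_mp d).setIntegral_preimage_emb (MeasurableEquiv.measurableEmbedding _),
    dy_pre hd b hl, ← setIntegral_congr_set (dyBox_ae_ball b hl)]
  rfl

lemma dy_ae {d : ℕ} (hd : 0 < d) (b : Fin d → ℝ) {l : ℝ} (hl : 0 < l)
    {P : EuclideanSpace ℝ (Fin d) → Prop}
    (h : ∀ᵐ x ∂volume.restrict (cube d (dyX b l) (l * Real.sqrt d / 2)), P x) :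
    ∀ᵐ y ∂volume.restrict (dyBox b l), P (WithLp.toLp 2 y) := by
  have h1 := ((dy_mp d).restrict_preimage_emb (MeasurableEquiv.measurableEmbedding _)
    (cube d (dyX b l) (l * Real.sqrt d / 2))).quasiMeasurePreserving.ae h
  rw [dy_pre hd b hl, ← Measure.restrict_congr_set (dyBox_ae_ball b hl)] at h1
  exact h1

lemma dyV_int {d : ℕ} {u : EuclideanSpace ℝ (Fin d) → ℝ} (hu : LocallyIntegrable u volume) :
    LocallyIntegrable (dyV u) volume := by
  rw [locallyIntegrable_iff]
  intro k hk
  have hc : Continuous (WithLp.toLp 2 : (Fin d → ℝ) → EuclideanSpace ℝ (Fin d)) :=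
    PiLp.continuous_toLp 2 _
  have h1 := hu.integrableOn_isCompact (hk.image hc)
  have h2 := ((dy_mp d).integrableOn_comp_preimage
    (MeasurableEquiv.measurableEmbedding _)).2 h1
  exact h2.mono_set (Set.subset_preimage_image _ _)

lemma dyV_nonneg {d : ℕ} {u : EuclideanSpace ℝ (Fin d) → ℝ} (hu : ∀ᵐ x, 0 < u x) :
    ∀ᵐ y, 0 ≤ dyV u y := by
  filter_upwards [(dy_mp d).quasiMeasurePreserving.ae hu] with y hy using le_of_lt hy

lemma dy_restrict_ne {d : ℕ} (hd : 0 < d) (b : Fin d → ℝ) {l : ℝ} (hl : 0 < l) :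
    (volume.restrict (cube d (dyX b l) (l * Real.sqrt d / 2))) ≠ 0 := by
  intro h
  rw [Measure.restrict_eq_zero, dy_cube_vol hd b hl, ENNReal.ofReal_eq_zero] at h
  have : 0 < l ^ d := by positivity
  linarith

lemma dy_inf_nonneg {d : ℕ} (hd : 0 < d) (b : Fin d → ℝ) {l : ℝ} (hl : 0 < l)
    {u : EuclideanSpace ℝ (Fin d) → ℝ} (hu : ∀ᵐ x, 0 < u x) :
    0 ≤ cubeInf (dyX b l) (l * Real.sqrt d / 2) u :=
  dy_le_essInf (dy_restrict_ne hd b hl)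
    (ae_restrict_of_ae (hu.mono fun _ h => h.le))

lemma dy_inf_le {d : ℕ} (hd : 0 < d) (b : Fin d → ℝ) {l : ℝ} (hl : 0 < l)
    {u : EuclideanSpace ℝ (Fin d) → ℝ} (hu : ∀ᵐ x, 0 < u x) :
    ∀ᵐ y ∂volume.restrict (dyBox b l),
      cubeInf (dyX b l) (l * Real.sqrt d / 2) u ≤ dyV u y :=
  dy_ae (P := fun x => cubeInf (dyX b l) (l * Real.sqrt d / 2) u ≤ u x) hd b hl
    (dy_essInf_le (ae_restrict_of_ae (hu.mono fun _ h => h.le)))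

lemma dy_inf_rpow {d : ℕ} (hd : 0 < d) (b : Fin d → ℝ) {l : ℝ} (hl : 0 < l)
    {u : EuclideanSpace ℝ (Fin d) → ℝ} (hu : ∀ᵐ x, 0 < u x) {p : ℝ} (hp : 0 ≤ p) :
    cubeInf (dyX b l) (l * Real.sqrt d / 2) u ^ p ≤
      cubeInf (dyX b l) (l * Real.sqrt d / 2) (fun x => u x ^ p) := by
  refine dy_le_essInf (dy_restrict_ne hd b hl) ?_
  filter_upwards [dy_essInf_le (μ := volume.restrict (cube d (dyX b l) (l * Real.sqrt d / 2)))
    (ae_restrict_of_ae (hu.mono fun _ h => h.le))] with x hx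
  exact Real.rpow_le_rpow (dy_inf_nonneg hd b hl hu) hx hp

lemma dy_dist {d : ℕ} (hd : 0 < d) {a b : Fin d → ℝ} {L l : ℝ} (hL : 0 < L) (hl : 0 < l)
    (hs : dyBox b l ⊆ dyBox a L) :
    dist (dyX a L) (dyX b l) ≤ L * Real.sqrt d / 2 := by
  have hmem : (fun i => b i + l / 2) ∈ dyBox a L := by
    apply hs
    rw [dyBox_mem]
    intro i
    constructor <;> linarith
  rw [dyBox_mem] at hmem
  rw [EuclideanSpace.dist_eq]
  apply Real.sqrt_le_iff.2
  refine ⟨by positivity, ?_⟩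
  calc ∑ i, dist ((dyX a L) i) ((dyX b l) i) ^ 2 ≤ ∑ i : Fin d, (L / 2) ^ 2 := by
        refine Finset.sum_le_sum fun i _ => ?_
        have := hmem i
        refine pow_le_pow_left₀ dist_nonneg ?_ 2
        rw [Real.dist_eq, abs_le]
        simp only [dyX]
        constructor <;> linarith [this.1, this.2]
    _ = (L * Real.sqrt d / 2) ^ 2 := by
        rw [Finset.sum_const, Finset.card_univ, Fintype.card_fin, nsmul_eq_mul, div_pow, div_pow,
          mul_pow, Real.sq_sqrt (by positivity)]
        ring

lemma dy_main {d : ℕ} (hd : 0 < d) (ρ : EuclideanSpace ℝ (Fin d) → ℝ)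
    (C₀ N₀ : ℝ) (hC₀ : 0 < C₀) (hN₀ : 1 ≤ N₀) (hρ : IsCRF ρ C₀ N₀)
    (u : EuclideanSpace ℝ (Fin d) → ℝ) (hu : IsWeight u) {θ C ε : ℝ} (hθ : 0 ≤ θ) (hC : 0 < C)
    (h : A1C ρ θ C u) (hε : 0 < ε) (hε1 : ε ≤ 1) (hK : 2 ^ d * ε * (C * 2 ^ θ) ≤ 1 / 2)
    (a : Fin d → ℝ) {L : ℝ} (hL : 0 < L) :
    cubeAvg (dyX a L) (L * Real.sqrt d / 2) (fun x => u x ^ (1 + ε)) ≤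
      (2 * ((2 * (1 + C₀)) ^ d * C) ^ (1 + ε)) *
        (1 + (L * Real.sqrt d / 2) / ρ (dyX a L)) ^ (((N₀ + 1) * d + θ) * (1 + ε)) *
        cubeInf (dyX a L) (L * Real.sqrt d / 2) (fun x => u x ^ (1 + ε)) := by
  obtain ⟨hu1, hu2⟩ := hu
  have hs : 0 < Real.sqrt d := Real.sqrt_pos.2 (by exact_mod_cast hd)
  have hv := dyV_int hu1
  have hv0 := dyV_nonneg hu2
  set r := L * Real.sqrt d / 2 with hr
  have hr0 : 0 < r := by positivity
  set x := dyX a L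
  have hρx := hρ.1 x
  set t := 1 + r / ρ x with ht
  have ht1 : 1 ≤ t := by
    have : 0 < r / ρ x := by positivity
    linarith
  have ht0 : 0 < t := by linarith
  set I := cubeInf x r u with hI
  have hI0 : 0 ≤ I := dy_inf_nonneg hd a hL hu2
  -- lower bound for ρ on the cube
  set σ := C₀⁻¹ * ρ x * t ^ (-N₀) with hσ
  have hσ0 : 0 < σ := by positivity
  have hρσ : ∀ b l, 0 < l → dyBox b l ⊆ dyBox a L → σ ≤ ρ (dyX b l) := by
    intro b l hl hsub
    refine le_trans ?_ (hρ.2 x (dyX b l)).1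
    have hdist : dist x (dyX b l) ≤ r := dy_dist hd hL hl hsub
    have h1 : 0 < 1 + dist x (dyX b l) / ρ x := by positivity
    have h2 : 1 + dist x (dyX b l) / ρ x ≤ t := by rw [ht]; gcongr
    have := Real.rpow_le_rpow_of_nonpos h1 h2 (by linarith : -N₀ ≤ 0)
    rw [hσ]
    gcongr
  -- choose the generation
  obtain ⟨n, hn1, hn2⟩ : ∃ n : ℕ, r / σ ≤ 2 ^ n ∧ (2 : ℝ) ^ n ≤ 2 * (1 + C₀) * t ^ (N₀ + 1) := by
    obtain ⟨k, hk1, hk2⟩ := exists_nat_pow_near (le_max_left 1 (r / σ)) (one_lt_two (α := ℝ))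
    refine ⟨k + 1, (le_max_right _ _).trans hk2.le, ?_⟩
    have e1 : r / σ = C₀ * (r / ρ x * t ^ N₀) := by
      rw [hσ, Real.rpow_neg ht0.le]
      have : 0 < t ^ N₀ := by positivity
      field_simp
    have e2 : r / σ ≤ C₀ * t ^ (N₀ + 1) := by
      rw [e1, Real.rpow_add ht0, Real.rpow_one, mul_comm (t ^ N₀)]
      gcongr
      rw [ht]; linarith
    have e3 : 1 ≤ t ^ (N₀ + 1) := Real.one_le_rpow ht1 (by linarith)
    have e4 : max 1 (r / σ) ≤ (1 + C₀) * t ^ (N₀ + 1) := by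
      have : 0 < C₀ * t ^ (N₀ + 1) := by positivity
      apply max_le <;> linarith
    rw [pow_succ]
    linarith
  -- uniform A1 on small boxes
  have small : ∀ b l, 0 < l → l ≤ L / 2 ^ n → dyBox b l ⊆ dyBox a L →
      ∀ᵐ y ∂volume.restrict (dyBox b l), dyAvg (dyV u) b l ≤ (C * 2 ^ θ) * dyV u y := by
    intro b l hl hlL hsub
    have hA := h (dyX b l) (l * Real.sqrt d / 2) (by positivity)
    rw [dy_cubeAvg hd b hl] at hA
    have hρb := hρσ b l hl hsub
    have hb0 := hρ.1 (dyX b l)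
    have hrat : l * Real.sqrt d / 2 / ρ (dyX b l) ≤ 1 := by
      rw [div_le_one hb0]
      refine le_trans ?_ hρb
      calc l * Real.sqrt d / 2 ≤ L / 2 ^ n * Real.sqrt d / 2 := by gcongr
        _ = r / 2 ^ n := by rw [hr]; ring
        _ ≤ σ := by
          rw [div_le_iff₀ hσ0] at hn1
          rw [div_le_iff₀ (by positivity)]
          linarith
    have hpos : 0 ≤ l * Real.sqrt d / 2 / ρ (dyX b l) := by positivity
    have hpow : (1 + l * Real.sqrt d / 2 / ρ (dyX b l)) ^ θ ≤ (2 : ℝ) ^ θ :=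
      Real.rpow_le_rpow (by linarith) (by linarith) hθ
    have hinf := dy_inf_nonneg hd b hl hu2
    filter_upwards [dy_inf_le hd b hl hu2] with y hy
    refine hA.trans ?_
    gcongr
  -- bound averages on generation n
  set Θ := (N₀ + 1) * d + θ with hΘ
  set A := (2 * (1 + C₀)) ^ d * C with hAdef
  have hA0 : 0 < A := by positivity
  have hAvg : dyAvg (dyV u) a L ≤ C * t ^ θ * I := by
    have := h x r hr0
    rwa [dy_cubeAvg hd a hL] at this
  have hLn : 0 < L / 2 ^ n := by positivity
  have gen : ∀ b, dyBox b (L / 2 ^ n) ⊆ dyBox a L →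
      dyAvg (dyV u) b (L / 2 ^ n) ≤ A * t ^ Θ * I := by
    intro b hb
    refine (dyAvg_mono hv hv0 hL hLn hb).trans ?_
    have e : L / (L / 2 ^ n) = 2 ^ n := by field_simp
    rw [e]
    calc ((2 : ℝ) ^ n) ^ d * dyAvg (dyV u) a L
        ≤ (2 * (1 + C₀) * t ^ (N₀ + 1)) ^ d * (C * t ^ θ * I) := by
          gcongr
          exact dyAvg_nonneg hv0 a hL
      _ = _ := by
          rw [hΘ, Real.rpow_add ht0 ((N₀ + 1) * d) θ, Real.rpow_mul ht0.le, Real.rpow_natCast,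
            mul_pow (2 * (1 + C₀)), hAdef]
          ring
  set B := 2 * (A * t ^ Θ * I) ^ (1 + ε) with hB
  have hB0 : 0 ≤ B := by positivity
  have hlin : ∫⁻ y in dyBox a L, ENNReal.ofReal (dyV u y ^ (1 + ε)) ≤
      ENNReal.ofReal B * volume (dyBox a L) := by
    refine dy_subdiv _ _ n a L hL fun b hb => ?_
    refine (dy_RH hv hv0 hε hε1 hK b hLn ?_).trans ?_
    · intro b' l hl hlL hsub
      exact small b' l hl hlL (hsub.trans hb)
    · rw [dyBox_vol b hLn.le, ← ENNReal.ofReal_mul hB0]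
      apply ENNReal.ofReal_le_ofReal
      have := Real.rpow_le_rpow (dyAvg_nonneg hv0 b hLn) (gen b hb) (by linarith : 0 ≤ 1 + ε)
      have h3 := mul_le_mul_of_nonneg_left this (show 0 ≤ (L / 2 ^ n) ^ d by positivity)
      rw [hB]
      linarith
  have hfin : dyAvg (dyV fun x => u x ^ (1 + ε)) a L ≤ B := by
    change (L ^ d)⁻¹ * ∫ y in dyBox a L, dyV u y ^ (1 + ε) ≤ B
    rw [inv_mul_le_iff₀ (by positivity)]
    by_cases hIntg : IntegrableOn (fun y => dyV u y ^ (1 + ε)) (dyBox a L)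
    · rw [← ofReal_integral_eq_lintegral_ofReal hIntg, dyBox_vol a hL.le,
        ← ENNReal.ofReal_mul hB0, ENNReal.ofReal_le_ofReal_iff (by positivity)] at hlin
      · linarith
      · filter_upwards [ae_restrict_of_ae hv0] with y hy using Real.rpow_nonneg hy _
    · rw [integral_undef hIntg]; positivity
  rw [dy_cubeAvg hd a hL]
  refine hfin.trans ?_
  have hInf := dy_inf_rpow hd a hL hu2 (show 0 ≤ 1 + ε by linarith)
  calc B = (2 * A ^ (1 + ε)) * t ^ (Θ * (1 + ε)) * I ^ (1 + ε) := by
        rw [hB, Real.mul_rpow (by positivity) hI0, Real.mul_rpow hA0.le (by positivity),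
          ← Real.rpow_mul ht0.le]
        ring
    _ ≤ _ := by
        refine mul_le_mul_of_nonneg_left hInf (by positivity)

lemma dy_zero (ρ w : EuclideanSpace ℝ (Fin 0) → ℝ) : A1 ρ w := by
  refine ⟨0, le_rfl, 1, one_pos, fun x r _ => ?_⟩
  have hw : w = fun _ => w 0 := by
    funext y; congr 1; exact Subsingleton.elim _ _
  have hc : cube 0 x r = Set.univ := by
    ext y; simp [cube]
  rw [hw]
  unfold cubeAvg cubeInf
  rw [hc, Measure.restrict_univ, volume_euclideanSpace_eq_dirac]
  rw [essInf_const _ (by simp)]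
  simp

end DyadicHelpers

/-- If `u ∈ A₁^ρ` then there is `ε₀ > 0` with `u^{1+ε} ∈ A₁^ρ` for all
`0 < ε ≤ ε₀`. -/
theorem A1_power_self_improvement {d : ℕ} (ρ : EuclideanSpace ℝ (Fin d) → ℝ)
    (C₀ N₀ : ℝ) (hC₀ : 0 < C₀) (hN₀ : 1 ≤ N₀) (hρ : IsCRF ρ C₀ N₀)
    (u : EuclideanSpace ℝ (Fin d) → ℝ) (hu : IsWeight u) (h : A1 ρ u) :
    ∃ ε₀ > 0, ∀ ε : ℝ, 0 < ε → ε ≤ ε₀ → A1 ρ (fun x => u x ^ (1 + ε)) := by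
  obtain ⟨θ, hθ, C, hC, hA⟩ := h
  rcases Nat.eq_zero_or_pos d with rfl | hd
  · exact ⟨1, one_pos, fun ε _ _ => dy_zero ρ _⟩
  have hKpos : (0 : ℝ) < 2 * (2 ^ d * (C * 2 ^ θ)) := by positivity
  refine ⟨min 1 (1 / (2 * (2 ^ d * (C * 2 ^ θ)))), by positivity, fun ε hε hεle => ?_⟩
  have hε1 : ε ≤ 1 := hεle.trans (min_le_left _ _)
  have hε2 := hεle.trans (min_le_right _ _)
  rw [le_div_iff₀ hKpos] at hε2
  have hN : 0 ≤ ((N₀ + 1) * d + θ) * (1 + ε) := by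
    have : 0 ≤ (N₀ + 1) * d := mul_nonneg (by linarith) (Nat.cast_nonneg d)
    exact mul_nonneg (by linarith) (by linarith)
  refine ⟨_, hN, 2 * ((2 * (1 + C₀)) ^ d * C) ^ (1 + ε), by positivity, fun x r hr => ?_⟩
  have hs : 0 < Real.sqrt d := Real.sqrt_pos.2 (by exact_mod_cast hd)
  have key := dy_main hd ρ C₀ N₀ hC₀ hN₀ hρ u hu hθ hC hA hε hε1 (by linarith)
    (fun i => x i - r / Real.sqrt d) (L := 2 * r / Real.sqrt d) (by positivity)
  have e1 : 2 * r / Real.sqrt d * Real.sqrt d / 2 = r := by field_simp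
  have e2 : dyX (fun i => x i - r / Real.sqrt d) (2 * r / Real.sqrt d) = x := by
    ext i
    simp only [dyX]
    ring
  rw [e1, e2] at key
  exact key

end
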